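/- (Multiplicativity of the resultant.) If F_0, ..., F_n ∈ ℂ[x_0,...,x_n] are homogeneous and F_j = F_j' · F_j'' is a factorization of F_j into homogeneous polynomials, then Res(F_0, ..., F_j, ..., F_n) = Res(F_0, ..., F_j', ..., F_n) · Res(F_0, ..., F_j'', ..., F_n), where each resultant is taken with respect to the appropriate degree sequence. -/

import Mathlib

open MvPolynomial

/-- `Mono m e` is the type of exponent vectors of total degree `e` in `m` variables. -/
abbrev Mono (m e : ℕ) : Type := {α : Fin m → ℕ // ∑ j, α j = e}

instance (m e : ℕ) : Fintype (Mono m e) :=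
  Fintype.subtype (Finset.Nat.antidiagonalTuple m e) fun _ => Finset.Nat.mem_antidiagonalTuple

/-- The exponent vector as a finitely supported function (a monomial of `MvPolynomial`). -/
noncomputable abbrev Mono.toFinsupp {m e : ℕ} (α : Mono m e) : Fin m →₀ ℕ :=
  Finsupp.equivFunOnFinite.symm α.1

/-- The index type for the variables `u_{i,α}` of the universal ring of coefficients
`ℤ[u_{i,α} : i, |α| = d i]` for `m` forms of degrees `d 0, …, d (m-1)` in `m` variables. -/
abbrev CoeffIdx (m : ℕ) (d : Fin m → ℕ) : Type := Σ i : Fin m, Mono m (d i)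

/-- Evaluation `P ↦ P(F_0, …, F_{m-1})` : each universal variable `u_{i,α}` is replaced by the
corresponding coefficient `c_{i,α}` of `F_i`. -/
noncomputable def resEval {m : ℕ} (d : Fin m → ℕ) (F : Fin m → MvPolynomial (Fin m) ℂ)
    (R : MvPolynomial (CoeffIdx m d) ℤ) : ℂ :=
  eval₂ (Int.castRingHom ℂ) (fun v => coeff v.2.toFinsupp (F v.1)) R

/-- `IsResultant m d R` says that `R` is *the* resultant polynomial `Res_{d_0,…,d_n}` (`m = n+1`):
(1) for homogeneous `F_i` of degrees `d i`, the system `F_0 = ⋯ = F_n = 0` has a nontrivial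
solution over `ℂ` iff `R(F_0,…,F_n) = 0`; (2) `R` is irreducible, even over `ℂ`;
(3) `R(x_0^{d_0},…,x_n^{d_n}) = 1`. -/
def IsResultant (m : ℕ) (d : Fin m → ℕ) (R : MvPolynomial (CoeffIdx m d) ℤ) : Prop :=
  (∀ F : Fin m → MvPolynomial (Fin m) ℂ, (∀ i, (F i).IsHomogeneous (d i)) →
    ((∃ x : Fin m → ℂ, x ≠ 0 ∧ ∀ i, eval x (F i) = 0) ↔ resEval d F R = 0)) ∧
  Irreducible R ∧ Irreducible (MvPolynomial.map (Int.castRingHom ℂ) R) ∧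
  resEval d (fun i => X i ^ d i) R = 1

/-- The vector of coefficients of a family of forms of degrees `d`. -/
noncomputable def coeffVec {m : ℕ} {A : Type*} [CommSemiring A] (d : Fin m → ℕ)
    (F : Fin m → MvPolynomial (Fin m) A) : CoeffIdx m d → A :=
  fun v => coeff v.2.toFinsupp (F v.1)

/-- The family of forms of degrees `d` with a given vector of coefficients. -/
noncomputable def formOf {m : ℕ} {A : Type*} [CommSemiring A] (d : Fin m → ℕ)
    (c : CoeffIdx m d → A) (i : Fin m) : MvPolynomial (Fin m) A :=
  ∑ α : Mono m (d i), monomial α.toFinsupp (c ⟨i, α⟩)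

lemma Mono.toFinsupp_injective {m e : ℕ} :
    Function.Injective (Mono.toFinsupp : Mono m e → (Fin m →₀ ℕ)) :=
  fun _ _ h => Subtype.ext (Finsupp.equivFunOnFinite.symm.injective h)

lemma Mono.degree_toFinsupp {m e : ℕ} (α : Mono m e) : α.toFinsupp.degree = e := by
  rw [Finsupp.degree_eq_sum]
  exact α.2

lemma formOf_isHomogeneous {m : ℕ} {A : Type*} [CommSemiring A] (d : Fin m → ℕ)
    (c : CoeffIdx m d → A) (i : Fin m) : (formOf d c i).IsHomogeneous (d i) :=
  IsHomogeneous.sum _ _ _ fun α _ => isHomogeneous_monomial _ α.degree_toFinsupp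

lemma coeff_formOf {m : ℕ} {A : Type*} [CommSemiring A] (d : Fin m → ℕ)
    (c : CoeffIdx m d → A) (i : Fin m) (α : Mono m (d i)) :
    coeff α.toFinsupp (formOf d c i) = c ⟨i, α⟩ := by
  classical
  rw [formOf, coeff_sum, Finset.sum_eq_single α]
  · simp
  · intro β _ hβ
    rw [coeff_monomial, if_neg fun h => hβ (Mono.toFinsupp_injective h)]
  · simp

lemma coeffVec_formOf {m : ℕ} {A : Type*} [CommSemiring A] (d : Fin m → ℕ)
    (c : CoeffIdx m d → A) : coeffVec d (formOf d c) = c :=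
  funext fun v => coeff_formOf d c v.1 v.2

lemma map_formOf {m : ℕ} {A B : Type*} [CommSemiring A] [CommSemiring B] (f : A →+* B)
    (d : Fin m → ℕ) (c : CoeffIdx m d → A) (i : Fin m) :
    map f (formOf d c i) = formOf d (fun v => f (c v)) i := by
  simp [formOf, map_sum]

lemma formOf_coeff {m : ℕ} {A : Type*} [CommSemiring A] (d : Fin m → ℕ) (i : Fin m)
    (c : CoeffIdx m d → A) (F : MvPolynomial (Fin m) A) (hF : F.IsHomogeneous (d i))
    (hc : ∀ α : Mono m (d i), c ⟨i, α⟩ = coeff α.toFinsupp F) : formOf d c i = F := by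
  ext β
  by_cases hβ : β.degree = d i
  · have hs : ∑ k, β k = d i := by rw [← hβ, Finsupp.degree_eq_sum]
    have h : Mono.toFinsupp (⟨β, hs⟩ : Mono m (d i)) = β := by ext; rfl
    rw [← h, coeff_formOf, hc]
  · rw [(formOf_isHomogeneous d c i).coeff_eq_zero hβ, hF.coeff_eq_zero hβ]

/-- `p` vanishes at the coefficients of a family of forms exactly when these forms have a
nontrivial common zero. -/
def DetectsZeros {m : ℕ} (d : Fin m → ℕ) (p : MvPolynomial (CoeffIdx m d) ℂ) : Prop :=
  ∀ F : Fin m → MvPolynomial (Fin m) ℂ, (∀ i, (F i).IsHomogeneous (d i)) →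
    ((∃ x : Fin m → ℂ, x ≠ 0 ∧ ∀ i, eval x (F i) = 0) ↔ eval (coeffVec d F) p = 0)

lemma resEval_eq_eval {m : ℕ} (d : Fin m → ℕ) (F : Fin m → MvPolynomial (Fin m) ℂ)
    (R : MvPolynomial (CoeffIdx m d) ℤ) :
    resEval d F R = eval (coeffVec d F) (map (Int.castRingHom ℂ) R) := by
  rw [eval_map]
  rfl

lemma exists_dvd_pow_of_zeros {σ : Type*} [Finite σ] {p q : MvPolynomial σ ℂ}
    (h : ∀ x, eval x p = 0 → eval x q = 0) : ∃ k, p ∣ q ^ k := by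
  have hq : q ∈ (Ideal.span {p}).radical := by
    rw [← vanishingIdeal_zeroLocus_eq_radical (K := ℂ), mem_vanishingIdeal_iff]
    intro x hx
    exact h x (hx p (Ideal.mem_span_singleton_self p))
  obtain ⟨k, hk⟩ := hq
  exact ⟨k, Ideal.mem_span_singleton.mp hk⟩

lemma prime_rename_of_injective {σ τ R : Type*} [CommRing R] {f : σ → τ}
    (hf : Function.Injective f) {p : MvPolynomial σ R} (hp : Prime p) : Prime (rename f p) := by
  have h : rename f p =
      rename ((↑) : Set.range f → τ) (rename (Equiv.ofInjective f hf) p) := by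
    rw [rename_rename]
    rfl
  rw [h, prime_rename_iff]
  exact (MulEquiv.prime_iff (renameEquiv R (Equiv.ofInjective f hf))).mpr hp

/-- The polynomial obtained from `p` by substituting `a + X` for the variable `v` and constants for
the other variables. -/
noncomputable def lineSubst {σ : Type*} [DecidableEq σ] (v : σ) (c : σ → ℂ)
    (p : MvPolynomial σ ℂ) : Polynomial ℂ :=
  aeval (fun w => Polynomial.C (c w) + if w = v then Polynomial.X else 0) p

lemma eval_lineSubst {σ : Type*} [DecidableEq σ] (v : σ) (c : σ → ℂ) (p : MvPolynomial σ ℂ)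
    (t : ℂ) : (lineSubst v c p).eval t = eval (fun w => c w + if w = v then t else 0) p := by
  rw [lineSubst, ← Polynomial.coe_evalRingHom, map_aeval]
  congr 1
  rw [eval]
  congr 1
  · ext; simp
  · ext w
    split_ifs <;> simp [*]

lemma natDegree_lineSubst_le {σ : Type*} [DecidableEq σ] (v : σ) (c : σ → ℂ)
    (p : MvPolynomial σ ℂ) : (lineSubst v c p).natDegree ≤ degreeOf v p := by
  rw [lineSubst, aeval_def, eval₂_eq]
  refine Polynomial.natDegree_sum_le_of_forall_le _ _ fun s hs => ?_
  refine (Polynomial.natDegree_C_mul_le _ _).trans <|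
    (Polynomial.natDegree_prod_le _ _).trans ?_
  refine le_trans ?_ (monomial_le_degreeOf v hs)
  calc _ ≤ ∑ w ∈ s.support, if w = v then s v else 0 := by
        refine Finset.sum_le_sum fun w _ => ?_
        split_ifs with h
        · subst h
          exact (Polynomial.natDegree_pow_le).trans
            (by simp)
        · rw [add_zero, ← Polynomial.C_pow, Polynomial.natDegree_C]
    _ ≤ s v := by
        rw [Finset.sum_ite_eq']
        split_ifs <;> simp

/-- The Macaulay matrix of the forms with coefficients `c`: the row of a monomial `α` holds the
coefficients of the form with index `ι α`, shifted so that `x_i ^ d i` becomes `α`. -/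
noncomputable def macaulayMatrix {m e : ℕ} {A : Type*} [CommSemiring A] (d : Fin m → ℕ)
    (ι : Mono m e → Fin m) (c : CoeffIdx m d → A) : Matrix (Mono m e) (Mono m e) A :=
  Matrix.of fun α β => coeff β.toFinsupp
    (monomial (α.toFinsupp - Finsupp.single (ι α) (d (ι α))) 1 * formOf d c (ι α))

lemma map_macaulayMatrix {m e : ℕ} {A B : Type*} [CommSemiring A] [CommSemiring B] (f : A →+* B)
    (d : Fin m → ℕ) (ι : Mono m e → Fin m) (c : CoeffIdx m d → A) :
    (macaulayMatrix d ι c).map f = macaulayMatrix d ι fun v => f (c v) := by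
  ext α β
  simp only [macaulayMatrix, Matrix.map_apply, Matrix.of_apply]
  rw [← map_formOf, ← coeff_map, map_mul, map_monomial, map_one]

lemma single_le_toFinsupp {m e : ℕ} {d : Fin m → ℕ} {α : Mono m e} {i : Fin m}
    (h : d i ≤ α.1 i) : Finsupp.single i (d i) ≤ α.toFinsupp := by
  rw [Finsupp.single_le_iff]
  exact h

lemma macaulayMatrix_X_pow {m e : ℕ} {d : Fin m → ℕ} {ι : Mono m e → Fin m}
    (hι : ∀ α, d (ι α) ≤ α.1 (ι α)) :
    macaulayMatrix d ι (coeffVec d fun i => (X i ^ d i : MvPolynomial (Fin m) ℂ)) = 1 := by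
  classical
  ext α β
  rw [macaulayMatrix, Matrix.of_apply, formOf_coeff d (ι α) _ (X (ι α) ^ d (ι α))
    (by simpa using (isHomogeneous_X ℂ (ι α)).pow (d (ι α))) (fun _ => rfl),
    X_pow_eq_monomial, monomial_mul, tsub_add_cancel_of_le (single_le_toFinsupp (hι α)),
    coeff_monomial, Matrix.one_apply]
  simp [Mono.toFinsupp_injective.eq_iff]

lemma macaulayMatrix_mulVec {m e : ℕ} {d : Fin m → ℕ} {ι : Mono m e → Fin m}
    (hι : ∀ α, d (ι α) ≤ α.1 (ι α)) (c : CoeffIdx m d → ℂ) (x : Fin m → ℂ)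
    (hx : ∀ i, eval x (formOf d c i) = 0) :
    (macaulayMatrix d ι c).mulVec (fun β => ∏ k, x k ^ β.1 k) = 0 := by
  ext α
  set P := monomial (α.toFinsupp - Finsupp.single (ι α) (d (ι α))) 1 * formOf d c (ι α) with hP
  have hdeg : P.IsHomogeneous e := by
    have h := (isHomogeneous_monomial (1 : ℂ) rfl).mul (formOf_isHomogeneous d c (ι α))
      (m := (α.toFinsupp - Finsupp.single (ι α) (d (ι α))).degree)
    convert h using 1
    have h2 := congrArg (fun s : Fin m →₀ ℕ => s.degree)
      (tsub_add_cancel_of_le (single_le_toFinsupp (hι α)))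
    simp only [map_add, Finsupp.degree_single, α.degree_toFinsupp] at h2
    exact h2.symm
  have hform : formOf (fun _ : Fin m => e)
      (fun v => coeff v.2.toFinsupp P) (ι α) = P :=
    formOf_coeff (fun _ => e) (ι α) _ P hdeg fun _ => rfl
  have h0 : eval x P = 0 := by rw [hP, map_mul, hx, mul_zero]
  rw [← hform, formOf, map_sum] at h0
  simp only [eval_monomial] at h0
  rw [Pi.zero_apply, ← h0, Matrix.mulVec, dotProduct]
  refine Finset.sum_congr rfl fun β _ => ?_
  rw [Finsupp.prod_fintype]
  · rfl
  · simp

lemma det_macaulayMatrix_eq_zero {m e : ℕ} {d : Fin m → ℕ} {ι : Mono m e → Fin m}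
    (hι : ∀ α, d (ι α) ≤ α.1 (ι α)) (c : CoeffIdx m d → ℂ) (x : Fin m → ℂ) (hx0 : x ≠ 0)
    (hx : ∀ i, eval x (formOf d c i) = 0) : (macaulayMatrix d ι c).det = 0 := by
  classical
  refine Matrix.exists_mulVec_eq_zero_iff.mp ⟨_, fun h => ?_, macaulayMatrix_mulVec hι c x hx⟩
  obtain ⟨i, hi⟩ := Function.ne_iff.mp hx0
  have h2 := congrFun h ⟨Pi.single i e, by simp⟩
  rw [Pi.zero_apply, Finset.prod_eq_zero_iff] at h2
  obtain ⟨k, -, hk⟩ := h2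
  by_cases hki : k = i
  · subst hki
    simp only [Pi.single_eq_same] at hk
    exact hi (by
      by_contra hne
      exact pow_ne_zero e hne hk)
  · simp [hki] at hk

lemma degreeOf_coeff_formOf_X_le {m : ℕ} (d : Fin m → ℕ) (i : Fin m) (μ : Fin m →₀ ℕ)
    (v : CoeffIdx m d) :
    degreeOf v (coeff μ (formOf d (X : CoeffIdx m d → MvPolynomial (CoeffIdx m d) ℂ) i)) ≤
      if i = v.1 then 1 else 0 := by
  classical
  by_cases hμ : μ.degree = d i
  · have hs : ∑ k, μ k = d i := by rw [← hμ, Finsupp.degree_eq_sum]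
    have h : Mono.toFinsupp (⟨μ, hs⟩ : Mono m (d i)) = μ := by ext; rfl
    rw [← h, coeff_formOf, degreeOf_X]
    by_cases hv : v = ⟨i, ⟨μ, hs⟩⟩
    · rw [if_pos hv, if_pos (by rw [hv])]
    · rw [if_neg hv]
      exact Nat.zero_le _
  · rw [(formOf_isHomogeneous d _ i).coeff_eq_zero hμ, degreeOf_zero]
    exact Nat.zero_le _

lemma degreeOf_det_macaulayMatrix_le {m e : ℕ} (d : Fin m → ℕ) (ι : Mono m e → Fin m)
    (v : CoeffIdx m d) :
    degreeOf v (macaulayMatrix d ι (X : CoeffIdx m d → MvPolynomial (CoeffIdx m d) ℂ)).det ≤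
      (Finset.univ.filter fun α => ι α = v.1).card := by
  classical
  rw [Matrix.det_apply]
  refine (degreeOf_sum_le _ _ _).trans (Finset.sup_le fun σ _ => ?_)
  have hs : degreeOf v (∏ α, macaulayMatrix d ι
      (X : CoeffIdx m d → MvPolynomial (CoeffIdx m d) ℂ) (σ α) α) ≤
      (Finset.univ.filter fun α => ι α = v.1).card := by
    refine (degreeOf_prod_le _ _ _).trans ?_
    rw [Finset.card_filter, ← Equiv.sum_comp σ fun α => if ι α = v.1 then 1 else 0]
    refine Finset.sum_le_sum fun α _ => ?_
    simp only [macaulayMatrix, Matrix.of_apply, coeff_monomial_mul', one_mul]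
    by_cases h : (σ α).toFinsupp - Finsupp.single (ι (σ α)) (d (ι (σ α))) ≤ α.toFinsupp
    · rw [if_pos h]
      exact degreeOf_coeff_formOf_X_le d _ _ v
    · rw [if_neg h, degreeOf_zero]
      exact Nat.zero_le _
  rcases Int.units_eq_one_or (Equiv.Perm.sign σ) with h | h <;> simpa [h] using hs


lemma exists_macaulay_index {m : ℕ} (d : Fin m → ℕ) (j : Fin m) :
    ∃ ι : Mono m (∑ i, (d i - 1) + 1) → Fin m, (∀ α, d (ι α) ≤ α.1 (ι α)) ∧
      (Finset.univ.filter fun α => ι α = j).card ≤ ∏ i, Function.update d j 1 i := by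
  classical
  have hex : ∀ α : Mono m (∑ i, (d i - 1) + 1), ∃ i, d i ≤ α.1 i ∧
      (i = j → ∀ k ≠ j, α.1 k < d k) := by
    intro α
    by_cases h : ∃ k, k ≠ j ∧ d k ≤ α.1 k
    · obtain ⟨k, hk, hdk⟩ := h
      exact ⟨k, hdk, fun h => absurd h hk⟩
    · push Not at h
      refine ⟨j, ?_, fun _ => h⟩
      by_contra! hj
      have hlt : ∀ i, α.1 i ≤ d i - 1 := by
        intro i
        by_cases hi : i = j
        · subst hi; omega
        · have := h i hi; omega
      have h1 := Finset.sum_le_sum fun i (_ : i ∈ Finset.univ) => hlt i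
      have h2 := α.2
      omega
  choose ι h1 h2 using hex
  refine ⟨ι, h1, ?_⟩
  have hcard : ∏ i, Function.update d j 1 i =
      (Fintype.piFinset fun i => Finset.range (Function.update d j 1 i)).card := by simp
  rw [hcard]
  refine Finset.card_le_card_of_injOn (fun α => Function.update α.1 j 0) ?_ ?_
  · intro α hα
    rw [Finset.mem_coe, Fintype.mem_piFinset]
    intro i
    rw [Finset.mem_range]
    by_cases hi : i = j
    · subst hi; simp
    · simpa [hi] using h2 α (by simpa using hα) i hi
  · intro α _ β _ h
    have hne : ∀ i ≠ j, α.1 i = β.1 i := fun i hi => by simpa [hi] using congrFun h i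
    refine Subtype.ext (funext fun i => ?_)
    by_cases hi : i = j
    · subst hi
      have ha := α.2
      have hb := β.2
      rw [← Finset.add_sum_erase _ _ (Finset.mem_univ i)] at ha hb
      have hs : ∑ k ∈ Finset.univ.erase i, α.1 k = ∑ k ∈ Finset.univ.erase i, β.1 k :=
        Finset.sum_congr rfl fun k hk => hne k (Finset.ne_of_mem_erase hk)
      omega
    · exact hne i hi

/-- The degree of the resultant in a coefficient of the `j`-th form is at most the product of the
other degrees. -/
lemma degreeOf_le_of_detectsZeros {m : ℕ} (d : Fin m → ℕ)
    (p : MvPolynomial (CoeffIdx m d) ℂ) (hp : Prime p) (hz : DetectsZeros d p)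
    (v : CoeffIdx m d) : degreeOf v p ≤ ∏ i, Function.update d v.1 1 i := by
  obtain ⟨ι, hι, hcard⟩ := exists_macaulay_index d v.1
  refine le_trans ?_ ((degreeOf_det_macaulayMatrix_le d ι v).trans hcard)
  set D := (macaulayMatrix d ι (X : CoeffIdx m d → MvPolynomial (CoeffIdx m d) ℂ)).det with hD
  have heval : ∀ c : CoeffIdx m d → ℂ, eval c D = (macaulayMatrix d ι c).det := by
    intro c
    rw [hD, RingHom.map_det, RingHom.mapMatrix_apply, map_macaulayMatrix]
    simp
  have hD0 : D ≠ 0 := by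
    intro h0
    have h1 := heval (coeffVec d fun i => (X i ^ d i : MvPolynomial (Fin m) ℂ))
    rw [macaulayMatrix_X_pow hι, h0] at h1
    simp at h1
  obtain ⟨k, hk⟩ := exists_dvd_pow_of_zeros (p := p) (q := D) fun c hc => by
    rw [← coeffVec_formOf d c] at hc
    obtain ⟨x, hx0, hx⟩ := (hz _ (formOf_isHomogeneous d c)).mpr hc
    rw [heval, det_macaulayMatrix_eq_zero hι c x hx0 hx]
  obtain ⟨q, hq⟩ := hp.dvd_of_dvd_pow hk
  have hq0 : q ≠ 0 := by rintro rfl; simp [hD0] at hq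
  rw [hq, degreeOf_mul_eq hp.ne_zero hq0]
  exact Nat.le_add_right _ _

/-- A one-parameter family of forms: for `i ≠ j`, the `i`-th form is a product of `N i` linear
forms, and the `j`-th form has degree `e` and meets the points cut out by the others, normalized by
`x_j = 1`, exactly when the parameter is the sum of their other coordinates. The slopes are chosen
such that these sums are `0, 1, …, ∏ i, N i - 1` when `N j = 1`. -/
noncomputable def lineFamily {m : ℕ} (N : Fin m → ℕ) (e : ℕ) (j : Fin m) (t : ℂ) (i : Fin m) :
    MvPolynomial (Fin m) ℂ :=
  if i = j then (C t * X j - ∑ k ∈ Finset.univ.erase j, X k) * X j ^ (e - 1)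
  else ∏ k ∈ Finset.range (N i),
    (X i - C ((k * ∏ l, N (Fin.castLE i.is_lt.le l) : ℕ) : ℂ) * X j)

lemma lineFamily_self {m : ℕ} (N : Fin m → ℕ) (e : ℕ) (j : Fin m) (t : ℂ) :
    lineFamily N e j t j = (C t * X j - ∑ k ∈ Finset.univ.erase j, X k) * X j ^ (e - 1) :=
  if_pos rfl

lemma lineFamily_of_ne {m : ℕ} (N : Fin m → ℕ) (e : ℕ) {j i : Fin m} (t : ℂ) (h : i ≠ j) :
    lineFamily N e j t i = ∏ k ∈ Finset.range (N i),
      (X i - C ((k * ∏ l, N (Fin.castLE i.is_lt.le l) : ℕ) : ℂ) * X j) :=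
  if_neg h

lemma lineFamily_isHomogeneous_self {m : ℕ} (N : Fin m → ℕ) {e : ℕ} (he : 0 < e) (j : Fin m)
    (t : ℂ) : (lineFamily N e j t j).IsHomogeneous e := by
  rw [lineFamily_self]
  have h1 : (C t * X j - ∑ k ∈ Finset.univ.erase j, X k : MvPolynomial (Fin m) ℂ).IsHomogeneous
      1 := by
    refine IsHomogeneous.sub ?_ (IsHomogeneous.sum _ _ _ fun k _ => isHomogeneous_X _ _)
    simpa using (isHomogeneous_C (Fin m) t).mul (isHomogeneous_X ℂ j)
  have h2 := h1.mul ((isHomogeneous_X ℂ j).pow (e - 1))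
  rwa [one_mul, Nat.add_sub_cancel' he] at h2

lemma lineFamily_isHomogeneous_of_ne {m : ℕ} (N : Fin m → ℕ) (e : ℕ) {j i : Fin m} (t : ℂ)
    (h : i ≠ j) : (lineFamily N e j t i).IsHomogeneous (N i) := by
  rw [lineFamily_of_ne N e t h]
  have h2 := IsHomogeneous.prod (Finset.range (N i))
    (fun k => (X i - C ((k * ∏ l, N (Fin.castLE i.is_lt.le l) : ℕ) : ℂ) * X j :
      MvPolynomial (Fin m) ℂ)) (fun _ => 1) fun k _ => by
    refine IsHomogeneous.sub (isHomogeneous_X _ _) ?_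
    simpa only [zero_add] using (isHomogeneous_C (Fin m) _).mul (isHomogeneous_X ℂ j)
  simpa using h2

lemma exists_zero_lineFamily {m : ℕ} (N : Fin m → ℕ) (e : ℕ) (j : Fin m) (hN : N j = 1) {k : ℕ}
    (hk : k < ∏ i, N i) :
    ∃ x : Fin m → ℂ, x ≠ 0 ∧ ∀ i, eval x (lineFamily N e j k i) = 0 := by
  set f := finPiFinEquiv.symm (⟨k, hk⟩ : Fin (∏ i, N i)) with hf
  have hfk : ∑ i, (f i : ℕ) * ∏ l, N (Fin.castLE i.is_lt.le l) = k := by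
    rw [← finPiFinEquiv_apply, hf, Equiv.apply_symm_apply]
  have hfj : (f j : ℕ) = 0 := by have := (f j).2; omega
  set y : Fin m → ℂ := fun i => ((f i * ∏ l, N (Fin.castLE i.is_lt.le l) : ℕ) : ℂ) with hy
  have hsum : ∑ i ∈ Finset.univ.erase j, y i = k := by
    rw [← Finset.add_sum_erase _ _ (Finset.mem_univ j), hfj, zero_mul, zero_add] at hfk
    rw [← hfk, Nat.cast_sum]
  refine ⟨Function.update y j 1, fun h => by simpa using congrFun h j, fun i => ?_⟩
  by_cases hi : i = j
  · subst hi
    have h2 : ∑ l ∈ Finset.univ.erase i, Function.update y i 1 l = k := by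
      rw [← hsum]
      exact Finset.sum_congr rfl fun l hl => Function.update_of_ne (Finset.ne_of_mem_erase hl) _ _
    rw [lineFamily_self, map_mul, map_sub, map_mul, map_sum]
    simp only [eval_X, eval_C, h2, Function.update_self, mul_one, sub_self, zero_mul]
  · rw [lineFamily_of_ne N e _ hi, map_prod]
    refine Finset.prod_eq_zero (Finset.mem_range.mpr (f i).2) ?_
    simp [hi, hy]

lemma eq_zero_of_lineFamily {m : ℕ} (N : Fin m → ℕ) (e : ℕ) (j : Fin m) (t : ℂ) (x : Fin m → ℂ)
    (hx : ∀ i ≠ j, eval x (lineFamily N e j t i) = 0) (hj : x j = 0) : x = 0 := by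
  funext i
  by_cases hi : i = j
  · rw [hi, hj]; rfl
  · have h := hx i hi
    rw [lineFamily_of_ne N e t hi, map_prod, Finset.prod_eq_zero_iff] at h
    obtain ⟨k, -, hk⟩ := h
    simpa [hj] using hk

lemma no_zero_lineFamily {m : ℕ} (N : Fin m → ℕ) (e : ℕ) (j : Fin m) :
    ¬ ∃ x : Fin m → ℂ, x ≠ 0 ∧ ∀ i, eval x (lineFamily N e j (-1) i) = 0 := by
  rintro ⟨x, hx0, hx⟩
  have hj : x j ≠ 0 := fun h => hx0 (eq_zero_of_lineFamily N e j _ x (fun i _ => hx i) h)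
  have h1 : ∀ i ∈ Finset.univ.erase j, ∃ k : ℕ, x i = k * x j := by
    intro i hi
    have h := hx i
    rw [lineFamily_of_ne N e _ (Finset.ne_of_mem_erase hi), map_prod,
      Finset.prod_eq_zero_iff] at h
    obtain ⟨k, -, hk⟩ := h
    exact ⟨_, by simpa only [map_sub, map_mul, eval_X, eval_C, sub_eq_zero] using hk⟩
  choose! k hk using h1
  have h2 := hx j
  rw [lineFamily_self, map_mul, map_pow, eval_X, mul_eq_zero, or_iff_left (pow_ne_zero _ hj),
    map_sub, map_mul, eval_X, eval_C, map_sum] at h2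
  simp only [eval_X] at h2
  rw [Finset.sum_congr rfl hk, ← Finset.sum_mul, ← sub_mul, mul_eq_zero, or_iff_left hj,
    ← Nat.cast_sum, sub_eq_zero] at h2
  have h3 : ((∑ i ∈ Finset.univ.erase j, k i + 1 : ℕ) : ℂ) = 0 := by
    rw [Nat.cast_add, ← h2]; simp
  exact Nat.succ_ne_zero _ (Nat.cast_eq_zero.mp h3)

/-- The exponent vector of the monomial `x_j ^ e`. -/
def Mono.pure {m : ℕ} (e : ℕ) (j : Fin m) : Mono m e := ⟨Pi.single j e, by simp⟩

lemma coeffVec_lineFamily {m : ℕ} (d N : Fin m → ℕ) (j : Fin m) (hj : 0 < d j) (t : ℂ)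
    (w : CoeffIdx m d) :
    coeffVec d (lineFamily N (d j) j t) w = coeffVec d (lineFamily N (d j) j 0) w +
      if w = ⟨j, Mono.pure (d j) j⟩ then t else 0 := by
  classical
  obtain ⟨i, α⟩ := w
  by_cases hi : i = j
  · subst hi
    have h : lineFamily N (d i) i t i =
        lineFamily N (d i) i 0 i + monomial (Mono.pure (d i) i).toFinsupp t := by
      have h2 : (Mono.pure (d i) i).toFinsupp = Finsupp.single i (d i) := by
        ext k
        rw [Finsupp.single_eq_pi_single]
        rfl
      have h3 : (X i : MvPolynomial (Fin m) ℂ) ^ d i = X i * X i ^ (d i - 1) := by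
        rw [← pow_succ', Nat.sub_add_cancel hj]
      rw [h2, ← C_mul_X_pow_eq_monomial, h3, lineFamily_self, lineFamily_self, C_0]
      ring
    simp only [coeffVec, h, coeff_add, coeff_monomial, Mono.toFinsupp_injective.eq_iff]
    simp [eq_comm]
  · have h : (⟨i, α⟩ : CoeffIdx m d) ≠ ⟨j, Mono.pure (d j) j⟩ :=
      fun h => hi (by simpa using congrArg Sigma.fst h)
    rw [if_neg h, add_zero]
    simp only [coeffVec, lineFamily_of_ne _ _ _ hi]

lemma le_natDegree_of_eval_natCast_eq_zero {q : Polynomial ℂ} (hq : q ≠ 0) {N : ℕ}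
    (h : ∀ k < N, q.eval (k : ℂ) = 0) : N ≤ q.natDegree := by
  by_contra! hlt
  refine hq (Polynomial.eq_zero_of_natDegree_lt_card_of_eval_eq_zero' q
    ((Finset.range N).map Nat.castEmbedding) ?_ ?_)
  · simpa using h
  · simpa using hlt

/-- Renames the variables of the universal ring of degrees `d'`, keeping only those of the `j`-th
form apart from the universal ring of degrees `d`. -/
def CoeffIdx.glue {m : ℕ} {d d' : Fin m → ℕ} (j : Fin m) (h : ∀ i ≠ j, d' i = d i)
    (v : CoeffIdx m d') : CoeffIdx m d ⊕ CoeffIdx m d' :=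
  if hv : v.1 = j then Sum.inr v else Sum.inl ⟨v.1, v.2.1, v.2.2.trans (h _ hv)⟩

lemma CoeffIdx.glue_injective {m : ℕ} {d d' : Fin m → ℕ} (j : Fin m) (h : ∀ i ≠ j, d' i = d i) :
    Function.Injective (CoeffIdx.glue j h) := by
  rintro ⟨i, α, hα⟩ ⟨k, β, hβ⟩ hv
  unfold CoeffIdx.glue at hv
  split_ifs at hv with h1 h2 h2
  · exact Sum.inr.inj hv
  · have h3 := Sum.inl.inj hv
    have h4 : i = k := congrArg Sigma.fst h3
    subst h4
    simpa using h3

/-- The forms given by a point of the glued coefficient space. -/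
noncomputable def gluedForm {m : ℕ} {d d' : Fin m → ℕ} {A : Type*} [CommSemiring A] (j : Fin m)
    (x : CoeffIdx m d ⊕ CoeffIdx m d' → A) (i : Fin m) : MvPolynomial (Fin m) A :=
  if i = j then formOf d' (x ∘ Sum.inr) i else formOf d (x ∘ Sum.inl) i

lemma gluedForm_isHomogeneous {m : ℕ} {d d' : Fin m → ℕ} {A : Type*} [CommSemiring A] (j : Fin m)
    (h : ∀ i ≠ j, d' i = d i) (x : CoeffIdx m d ⊕ CoeffIdx m d' → A) (i : Fin m) :
    (gluedForm j x i).IsHomogeneous (d' i) := by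
  unfold gluedForm
  split_ifs with hi
  · exact formOf_isHomogeneous _ _ _
  · rw [h i hi]
    exact formOf_isHomogeneous _ _ _

lemma coeffVec_gluedForm {m : ℕ} {d d' : Fin m → ℕ} {A : Type*} [CommSemiring A] (j : Fin m)
    (h : ∀ i ≠ j, d' i = d i) (x : CoeffIdx m d ⊕ CoeffIdx m d' → A) :
    coeffVec d' (gluedForm j x) = x ∘ CoeffIdx.glue j h := by
  funext v
  by_cases hv : v.1 = j
  · rw [coeffVec, gluedForm, if_pos hv, coeff_formOf, Function.comp_apply, Function.comp_apply,
      CoeffIdx.glue, dif_pos hv]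
  · rw [coeffVec, gluedForm, if_neg hv, Function.comp_apply, CoeffIdx.glue, dif_neg hv]
    exact coeff_formOf d _ v.1 ⟨v.2.1, v.2.2.trans (h _ hv)⟩

lemma map_gluedForm {m : ℕ} {d d' : Fin m → ℕ} {A B : Type*} [CommSemiring A] [CommSemiring B]
    (f : A →+* B) (j : Fin m) (x : CoeffIdx m d ⊕ CoeffIdx m d' → A) (i : Fin m) :
    map f (gluedForm j x i) = gluedForm j (fun v => f (x v)) i := by
  unfold gluedForm
  split_ifs <;> exact map_formOf _ _ _ _

lemma gluedForm_elim_coeffVec {m : ℕ} {d d' : Fin m → ℕ} (j : Fin m)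
    (F F' : Fin m → MvPolynomial (Fin m) ℂ) (hF : ∀ i ≠ j, F' i = F i)
    (hFd : ∀ i, (F i).IsHomogeneous (d i)) (hFd' : (F' j).IsHomogeneous (d' j)) (i : Fin m) :
    gluedForm j (Sum.elim (coeffVec d F) (coeffVec d' F')) i = F' i := by
  unfold gluedForm
  split_ifs with hi
  · subst hi
    exact formOf_coeff d' i _ _ hFd' fun _ => rfl
  · rw [hF i hi]
    exact formOf_coeff d i _ _ (hFd i) fun _ => rfl

/-- The system of forms `F` arises from the systems `F'` and `F''` by multiplying their `j`-th
forms, the other forms being equal. -/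
structure IsFactored {m : ℕ} (j : Fin m) (d d' d'' : Fin m → ℕ)
    (F F' F'' : Fin m → MvPolynomial (Fin m) ℂ) : Prop where
  homogeneous : ∀ i, (F i).IsHomogeneous (d i)
  homogeneous_left : (F' j).IsHomogeneous (d' j)
  homogeneous_right : (F'' j).IsHomogeneous (d'' j)
  eq_left : ∀ i ≠ j, F' i = F i
  eq_right : ∀ i ≠ j, F'' i = F i
  eq_mul : F j = F' j * F'' j

/-- On factored systems, a prime polynomial detecting zeros is a product of powers of those of the
factors. -/
lemma exists_eval_eq_mul_pow_mul_pow {m : ℕ} (j : Fin m) {d d' d'' : Fin m → ℕ}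
    (h' : ∀ i ≠ j, d' i = d i) (h'' : ∀ i ≠ j, d'' i = d i) (hj : d j = d' j + d'' j)
    {p : MvPolynomial (CoeffIdx m d) ℂ} (hp : DetectsZeros d p)
    {p' : MvPolynomial (CoeffIdx m d') ℂ} (hp' : DetectsZeros d' p') (hpr' : Prime p')
    {p'' : MvPolynomial (CoeffIdx m d'') ℂ} (hp'' : DetectsZeros d'' p'') (hpr'' : Prime p'') :
    ∃ (c : ℂ) (a b : ℕ), c ≠ 0 ∧ ∀ F F' F'', IsFactored j d d' d'' F F' F'' →
      eval (coeffVec d F) p =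
        c * eval (coeffVec d' F') p' ^ a * eval (coeffVec d'' F'') p'' ^ b := by
  classical
  let τ := CoeffIdx m d ⊕ (CoeffIdx m d' ⊕ CoeffIdx m d'')
  let g' : CoeffIdx m d ⊕ CoeffIdx m d' → τ := Sum.map id Sum.inl
  let g'' : CoeffIdx m d ⊕ CoeffIdx m d'' → τ := Sum.map id Sum.inr
  have hg' : Function.Injective g' := Sum.map_injective.mpr ⟨fun _ _ h => h, Sum.inl_injective⟩
  have hg'' : Function.Injective g'' := Sum.map_injective.mpr ⟨fun _ _ h => h, Sum.inr_injective⟩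
  let form (i : Fin m) : MvPolynomial (Fin m) (MvPolynomial τ ℂ) :=
    if i = j then gluedForm j (fun v => X (g' v)) j * gluedForm j (fun v => X (g'' v)) j
    else formOf d (fun v => X (Sum.inl v)) i
  let formAt (x : τ → ℂ) (i : Fin m) : MvPolynomial (Fin m) ℂ :=
    if i = j then gluedForm j (x ∘ g') j * gluedForm j (x ∘ g'') j
    else formOf d (x ∘ Sum.inl) i
  have hformAt (x : τ → ℂ) (i : Fin m) : (formAt x i).IsHomogeneous (d i) := by
    simp only [formAt]
    split_ifs with hi
    · subst hi
      rw [hj]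
      exact (gluedForm_isHomogeneous i h' _ i).mul (gluedForm_isHomogeneous i h'' _ i)
    · exact formOf_isHomogeneous _ _ _
  let P : MvPolynomial τ ℂ := aeval (coeffVec d form) p
  let Q' := rename (g' ∘ CoeffIdx.glue j h') p'
  let Q'' := rename (g'' ∘ CoeffIdx.glue j h'') p''
  have hQ' : Prime Q' :=
    prime_rename_of_injective (hg'.comp (CoeffIdx.glue_injective j h')) hpr'
  have hQ'' : Prime Q'' :=
    prime_rename_of_injective (hg''.comp (CoeffIdx.glue_injective j h'')) hpr''
  have hPx (x : τ → ℂ) : eval x P = eval (coeffVec d (formAt x)) p := by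
    have h1 : eval x P = eval (fun v => eval x (coeffVec d form v)) p := by
      simp only [P]
      rw [map_aeval]
      exact congrArg (fun f : MvPolynomial (CoeffIdx m d) ℂ →+* ℂ => f p)
        (ringHom_ext (by simp) (by simp))
    rw [h1]
    congr 2
    funext v
    rw [coeffVec, coeffVec, ← coeff_map]
    congr 1
    simp only [form, formAt]
    split_ifs
    · rw [map_mul, map_gluedForm, map_gluedForm]
      simp only [eval_X]
      rfl
    · rw [map_formOf]
      simp only [eval_X]
      rfl
  have hQx' (x : τ → ℂ) : eval x Q' = eval (coeffVec d' (gluedForm j (x ∘ g'))) p' := by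
    simp only [Q', eval_rename, coeffVec_gluedForm j h']
    rfl
  have hQx'' (x : τ → ℂ) : eval x Q'' = eval (coeffVec d'' (gluedForm j (x ∘ g''))) p'' := by
    simp only [Q'', eval_rename, coeffVec_gluedForm j h'']
    rfl
  obtain ⟨k, hk⟩ := exists_dvd_pow_of_zeros (p := P) (q := Q' * Q'') fun x hx => by
    rw [hPx] at hx
    obtain ⟨y, hy0, hy⟩ := (hp _ (hformAt x)).mpr hx
    have hyj := hy j
    simp only [formAt, if_true, map_mul, mul_eq_zero] at hyj
    rw [map_mul, mul_eq_zero, hQx', hQx'']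
    refine hyj.imp (fun hyj => ?_) fun hyj => ?_
    · refine (hp' _ (gluedForm_isHomogeneous j h' _)).mp ⟨y, hy0, fun i => ?_⟩
      by_cases hi : i = j
      · rw [hi, hyj]
      · have := hy i
        simp only [formAt, if_neg hi] at this
        rw [gluedForm, if_neg hi]
        exact this
    · refine (hp'' _ (gluedForm_isHomogeneous j h'' _)).mp ⟨y, hy0, fun i => ?_⟩
      by_cases hi : i = j
      · rw [hi, hyj]
      · have := hy i
        simp only [formAt, if_neg hi] at this
        rw [gluedForm, if_neg hi]
        exact this
  rw [mul_pow] at hk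
  obtain ⟨A, B, hA, hB, hAB⟩ := exists_dvd_and_dvd_of_dvd_mul hk
  obtain ⟨a, -, ha⟩ := (dvd_prime_pow hQ' k).mp hA
  obtain ⟨b, -, hb⟩ := (dvd_prime_pow hQ'' k).mp hB
  obtain ⟨u, hu⟩ := (ha.mul_mul hb).symm
  rw [← hAB] at hu
  obtain ⟨c, hc, hcu⟩ := isUnit_iff_eq_C_of_isReduced.mp u.isUnit
  refine ⟨c, a, b, hc.ne_zero, fun F F' F'' hF => ?_⟩
  let x : τ → ℂ := Sum.elim (coeffVec d F) (Sum.elim (coeffVec d' F') (coeffVec d'' F''))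
  have hx' : x ∘ g' = Sum.elim (coeffVec d F) (coeffVec d' F') := by
    funext v; rcases v with v | v <;> rfl
  have hx'' : x ∘ g'' = Sum.elim (coeffVec d F) (coeffVec d'' F'') := by
    funext v; rcases v with v | v <;> rfl
  have e' : gluedForm j (x ∘ g') = F' := by
    rw [hx']
    exact funext (gluedForm_elim_coeffVec j F F' hF.eq_left hF.homogeneous hF.homogeneous_left)
  have e'' : gluedForm j (x ∘ g'') = F'' := by
    rw [hx'']
    exact funext (gluedForm_elim_coeffVec j F F'' hF.eq_right hF.homogeneous hF.homogeneous_right)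
  have e : formAt x = F := by
    funext i
    simp only [formAt, e', e'']
    split_ifs with hi
    · rw [hi, hF.eq_mul]
    · exact formOf_coeff d i _ _ (hF.homogeneous i) fun _ => rfl
  have hfin := congrArg (eval x) hu
  rw [map_mul, map_mul, map_pow, map_pow, hPx, hQx', hQx'', e, e', e'', hcu, eval_C] at hfin
  rw [← hfin]
  ring

/-- The exponent of the first factor is one. -/
lemma exponent_eq_one {m : ℕ} (j : Fin m) {d d' d'' : Fin m → ℕ} (hd : ∀ i, 0 < d i)
    (h' : ∀ i ≠ j, d' i = d i) (h'' : ∀ i ≠ j, d'' i = d i) (hj : d j = d' j + d'' j)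
    (hj' : 0 < d' j) (hj'' : 0 < d'' j)
    {p : MvPolynomial (CoeffIdx m d) ℂ} (hp : DetectsZeros d p) (hpr : Prime p)
    {p' : MvPolynomial (CoeffIdx m d') ℂ} (hp' : DetectsZeros d' p')
    {p'' : MvPolynomial (CoeffIdx m d'') ℂ} (hp'' : DetectsZeros d'' p'') {c : ℂ} {a b : ℕ}
    (hc : c ≠ 0) (heval : ∀ F F' F'', IsFactored j d d' d'' F F' F'' →
      eval (coeffVec d F) p =
        c * eval (coeffVec d' F') p' ^ a * eval (coeffVec d'' F'') p'' ^ b) : a = 1 := by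
  classical
  set N := Function.update d j 1 with hN
  have hNj : N j = 1 := Function.update_self _ _ _
  have hNi : ∀ i ≠ j, N i = d i := fun i hi => Function.update_of_ne hi _ _
  have hNpos : 0 < ∏ i, N i := Finset.prod_pos fun i _ => by
    by_cases hi : i = j
    · rw [hi, hNj]; exact one_pos
    · rw [hNi i hi]; exact hd i
  let G : Fin m → MvPolynomial (Fin m) ℂ := fun i =>
    if i = j then X j ^ d'' j else lineFamily N (d j) j 0 i
  have hG : ∀ i, (G i).IsHomogeneous (d'' i) := fun i => by
    simp only [G]
    split_ifs with hi
    · subst hi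
      simpa using (isHomogeneous_X ℂ i).pow (d'' i)
    · rw [h'' i hi, ← hNi i hi]
      exact lineFamily_isHomogeneous_of_ne _ _ _ hi
  have hhom' : ∀ t i, (lineFamily N (d' j) j t i).IsHomogeneous (d' i) := fun t i => by
    by_cases hi : i = j
    · subst hi
      exact lineFamily_isHomogeneous_self _ hj' _ _
    · rw [h' i hi, ← hNi i hi]
      exact lineFamily_isHomogeneous_of_ne _ _ _ hi
  have hfac : ∀ t, IsFactored j d d' d'' (lineFamily N (d j) j t) (lineFamily N (d' j) j t) G :=
    fun t =>
    { homogeneous := fun i => by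
        by_cases hi : i = j
        · subst hi
          exact lineFamily_isHomogeneous_self _ (hd i) _ _
        · rw [← hNi i hi]
          exact lineFamily_isHomogeneous_of_ne _ _ _ hi
      homogeneous_left := hhom' t j
      homogeneous_right := hG j
      eq_left := fun i hi => by rw [lineFamily_of_ne _ _ _ hi, lineFamily_of_ne _ _ _ hi]
      eq_right := fun i hi => by
        simp only [G, if_neg hi]
        rw [lineFamily_of_ne _ _ _ hi, lineFamily_of_ne _ _ _ hi]
      eq_mul := by
        simp only [G, if_true]
        rw [lineFamily_self, lineFamily_self, mul_assoc, ← pow_add, hj, Nat.sub_add_comm hj'] }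
  have hr : eval (coeffVec d'' G) p'' ≠ 0 := fun h0 => by
    obtain ⟨x, hx0, hx⟩ := (hp'' G hG).mpr h0
    refine hx0 (eq_zero_of_lineFamily N (d j) j 0 x (fun i hi => ?_) ?_)
    · simpa only [G, if_neg hi] using hx i
    · have := hx j
      simp only [G, if_true, map_pow, eval_X] at this
      exact eq_zero_of_pow_eq_zero this
  set P := lineSubst ⟨j, Mono.pure (d j) j⟩ (coeffVec d (lineFamily N (d j) j 0)) p with hP
  set Q := lineSubst ⟨j, Mono.pure (d' j) j⟩ (coeffVec d' (lineFamily N (d' j) j 0)) p' with hQ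
  have hPt : ∀ t, P.eval t = eval (coeffVec d (lineFamily N (d j) j t)) p := fun t => by
    rw [hP, eval_lineSubst]
    congr 2
    funext w
    rw [coeffVec_lineFamily d N j (hd j) t w]
  have hQt : ∀ t, Q.eval t = eval (coeffVec d' (lineFamily N (d' j) j t)) p' := fun t => by
    rw [hQ, eval_lineSubst]
    congr 2
    funext w
    rw [coeffVec_lineFamily d' N j hj' t w]
  have hPQ : P = Polynomial.C (c * eval (coeffVec d'' G) p'' ^ b) * Q ^ a := by
    refine Polynomial.funext fun t => ?_
    rw [hPt, heval _ _ _ (hfac t), ← hQt, Polynomial.eval_mul, Polynomial.eval_C,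
      Polynomial.eval_pow]
    ring
  have hcr : c * eval (coeffVec d'' G) p'' ^ b ≠ 0 := mul_ne_zero hc (pow_ne_zero _ hr)
  have hQ0 : Q ≠ 0 := fun h0 => by
    have h1 := hQt (-1)
    rw [h0, Polynomial.eval_zero] at h1
    exact no_zero_lineFamily N (d' j) j ((hp' _ (hhom' (-1))).mpr h1.symm)
  have hQdeg : ∏ i, N i ≤ Q.natDegree := le_natDegree_of_eval_natCast_eq_zero hQ0 fun k hk => by
    rw [hQt]
    exact (hp' _ (hhom' k)).mp (exists_zero_lineFamily N _ j hNj hk)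
  have hPdeg : P.natDegree ≤ ∏ i, N i :=
    (natDegree_lineSubst_le _ _ _).trans (degreeOf_le_of_detectsZeros d p hpr hp _)
  rw [hPQ, Polynomial.natDegree_C_mul hcr, Polynomial.natDegree_pow] at hPdeg
  have ha : a ≠ 0 := by
    rintro rfl
    have h0 := (hp _ (hfac (0 : ℕ)).homogeneous).mp (exists_zero_lineFamily N _ j hNj hNpos)
    rw [← hPt, hPQ, pow_zero, mul_one, Polynomial.eval_C] at h0
    exact hcr h0
  have ha1 : a ≤ 1 := by
    by_contra! h2
    have := Nat.mul_le_mul h2 hQdeg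
    omega
  omega

lemma IsFactored.swap {m : ℕ} {j : Fin m} {d d' d'' : Fin m → ℕ}
    {F F' F'' : Fin m → MvPolynomial (Fin m) ℂ} (h : IsFactored j d d' d'' F F' F'') :
    IsFactored j d d'' d' F F'' F' where
  homogeneous := h.homogeneous
  homogeneous_left := h.homogeneous_right
  homogeneous_right := h.homogeneous_left
  eq_left := h.eq_right
  eq_right := h.eq_left
  eq_mul := h.eq_mul.trans (mul_comm _ _)

lemma IsResultant.detectsZeros {m : ℕ} {d : Fin m → ℕ} {R : MvPolynomial (CoeffIdx m d) ℤ}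
    (h : IsResultant m d R) : DetectsZeros d (map (Int.castRingHom ℂ) R) := fun F hF => by
  rw [← resEval_eq_eval]
  exact h.1 F hF

lemma IsResultant.prime {m : ℕ} {d : Fin m → ℕ} {R : MvPolynomial (CoeffIdx m d) ℤ}
    (h : IsResultant m d R) : Prime (map (Int.castRingHom ℂ) R) :=
  h.2.2.1.prime

/-- Multiplicativity of the resultant: if `F j = F' * F''` with `F'`, `F''` homogeneous of
degrees `e'`, `e''`, then
`Res(F_0,…,F_j,…,F_n) = Res(F_0,…,F',…,F_n) ⬝ Res(F_0,…,F'',…,F_n)`,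
each resultant being taken for the appropriate degree sequence. -/
theorem resultant_multiplicative (n : ℕ) (d : Fin (n + 1) → ℕ) (hd : ∀ i, 0 < d i)
    (j : Fin (n + 1)) (e' e'' : ℕ) (he' : 0 < e') (he'' : 0 < e'') (he : d j = e' + e'')
    (R : MvPolynomial (CoeffIdx (n + 1) d) ℤ) (hR : IsResultant (n + 1) d R)
    (R' : MvPolynomial (CoeffIdx (n + 1) (Function.update d j e')) ℤ)
    (hR' : IsResultant (n + 1) (Function.update d j e') R')
    (R'' : MvPolynomial (CoeffIdx (n + 1) (Function.update d j e'')) ℤ)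
    (hR'' : IsResultant (n + 1) (Function.update d j e'') R'')
    (F : Fin (n + 1) → MvPolynomial (Fin (n + 1)) ℂ)
    (F' F'' : MvPolynomial (Fin (n + 1)) ℂ)
    (hF : ∀ i, (F i).IsHomogeneous (d i))
    (hF' : F'.IsHomogeneous e') (hF'' : F''.IsHomogeneous e'')
    (hfac : F j = F' * F'') :
    resEval d F R =
      resEval (Function.update d j e') (Function.update F j F') R' *
        resEval (Function.update d j e'') (Function.update F j F'') R'' := by
  have h' : ∀ i ≠ j, Function.update d j e' i = d i := fun i hi => Function.update_of_ne hi _ _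
  have h'' : ∀ i ≠ j, Function.update d j e'' i = d i := fun i hi => Function.update_of_ne hi _ _
  have hj : d j = Function.update d j e' j + Function.update d j e'' j := by
    rw [Function.update_self, Function.update_self, he]
  have hj' : 0 < Function.update d j e' j := by rwa [Function.update_self]
  have hj'' : 0 < Function.update d j e'' j := by rwa [Function.update_self]
  obtain ⟨c, a, b, hc, heval⟩ := exists_eval_eq_mul_pow_mul_pow j h' h'' hj
    hR.detectsZeros hR'.detectsZeros hR'.prime hR''.detectsZeros hR''.prime
  have ha : a = 1 := exponent_eq_one j hd h' h'' hj hj' hj'' hR.detectsZeros hR.prime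
    hR'.detectsZeros hR''.detectsZeros hc heval
  have hb : b = 1 := exponent_eq_one j hd h'' h' (hj.trans (add_comm _ _)) hj'' hj'
    hR.detectsZeros hR.prime hR''.detectsZeros hR'.detectsZeros hc fun F F'' F' hF => by
      rw [heval F F' F'' hF.swap, mul_right_comm]
  subst ha hb
  simp only [pow_one, ← resEval_eq_eval] at heval
  have hc1 : c = 1 := by
    have h := heval (fun i => X i ^ d i) (fun i => X i ^ Function.update d j e' i)
      (fun i => X i ^ Function.update d j e'' i)
      { homogeneous := fun i => isHomogeneous_X_pow i (d i)
        homogeneous_left := isHomogeneous_X_pow j _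
        homogeneous_right := isHomogeneous_X_pow j _
        eq_left := fun i hi => by rw [h' i hi]
        eq_right := fun i hi => by rw [h'' i hi]
        eq_mul := by rw [← pow_add, ← hj] }
    rw [hR.2.2.2, hR'.2.2.2, hR''.2.2.2] at h
    simpa using h.symm
  rw [heval F (Function.update F j F') (Function.update F j F'')
    { homogeneous := hF
      homogeneous_left := by simpa using hF'
      homogeneous_right := by simpa using hF''
      eq_left := fun i hi => Function.update_of_ne hi _ _
      eq_right := fun i hi => Function.update_of_ne hi _ _
      eq_mul := by simpa using hfac }, hc1, one_mul]
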